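/- Let z₁, …, z_n be points in ℝ², and let z̄ = (1/n)∑_{i=1}^n z_i be their center of mass. Then there exist indices i₁, i₂ ∈ {1, …, n} and λ ∈ [0,1] such that the point w = λ·z_{i₁} + (1−λ)·z_{i₂} satisfies w₁ ≥ z̄₁ (first coordinate) and w₂ ≤ z̄₂ (second coordinate). -/

import Mathlib

/-- Two families of reals with zero sum are made simultaneously nonnegative by a convex combination
of two indices. -/
theorem exists_pair_convexCombination_nonneg {ι : Type*} [Fintype ι] [Nonempty ι] (a b : ι → ℝ)
    (ha : ∑ i, a i = 0) (hb : ∑ i, b i = 0) :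
    ∃ (i j : ι) (t : ℝ), t ∈ Set.Icc (0 : ℝ) 1 ∧
      0 ≤ t * a i + (1 - t) * a j ∧ 0 ≤ t * b i + (1 - t) * b j := by
  by_cases hgood : ∃ i, 0 ≤ a i ∧ 0 ≤ b i
  · obtain ⟨i, hai, hbi⟩ := hgood
    exact ⟨i, i, 1, by simp, by simpa using hai, by simpa using hbi⟩
  push Not at hgood
  have hP : ∃ i, 0 < a i := by
    by_contra! h
    have hzero : ∀ i, a i = 0 := fun i =>
      (Finset.sum_eq_zero_iff_of_nonpos fun i _ => h i).1 ha i (Finset.mem_univ i)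
    have : ∑ i, b i < 0 :=
      Finset.sum_neg (fun i _ => hgood i (hzero i).ge) Finset.univ_nonempty
    exact this.ne hb
  -- choose the steepest index with positive first value
  obtain ⟨i, hi, hmax⟩ := Finset.exists_max_image (Finset.univ.filter fun i => 0 < a i)
    (fun i => a i / -b i) (by simpa [Finset.filter_nonempty_iff] using hP)
  simp only [Finset.mem_filter, Finset.mem_univ, true_and] at hi hmax
  have hbi := hgood i hi.le
  have hj : ∃ j, a j ≤ 0 ∧ 0 ≤ -b i * a j + a i * b j := by
    by_contra! h
    have hsum : ∑ j, (-b i * a j + a i * b j) = 0 := by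
      rw [Finset.sum_add_distrib, ← Finset.mul_sum, ← Finset.mul_sum, ha, hb]
      simp
    have hnonpos : ∀ j, -b i * a j + a i * b j ≤ 0 := by
      intro j
      rcases lt_or_ge 0 (a j) with hj | hj
      · have hr := hmax j hj
        have hbj := hgood j hj.le
        rw [div_le_div_iff₀ (by linarith) (by linarith)] at hr
        linarith
      · exact (h j hj).le
    have hzero := (Finset.sum_eq_zero_iff_of_nonpos fun j _ => hnonpos j).1 hsum
    have hpos : ∀ j, 0 < a j := fun j => by
      by_contra! hj
      exact (h j hj).ne (hzero j (Finset.mem_univ j))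
    exact (Finset.sum_pos (fun j _ => hpos j) Finset.univ_nonempty).ne' ha
  obtain ⟨j, haj, hf⟩ := hj
  have hbj : 0 ≤ b j := by
    by_contra! h
    nlinarith [mul_pos hi (neg_pos.2 h), mul_nonneg (neg_pos.2 hbi).le (neg_nonneg.2 haj)]
  have hd : 0 < b j - b i := by linarith
  have hcomp : 1 - b j / (b j - b i) = -b i / (b j - b i) := by
    field_simp
    ring
  refine ⟨i, j, b j / (b j - b i), ⟨by positivity, (div_le_one hd).2 (by linarith)⟩, ?_, ?_⟩
  · rw [hcomp, show b j / (b j - b i) * a i + -b i / (b j - b i) * a j =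
      (-b i * a j + a i * b j) / (b j - b i) by ring]
    exact div_nonneg hf hd.le
  · rw [hcomp]
    exact le_of_eq (by ring)

theorem stmt_8 (n : ℕ) (hn : 0 < n) (z : Fin n → ℝ × ℝ) :
    ∃ (i₁ i₂ : Fin n) (lam : ℝ), lam ∈ Set.Icc (0 : ℝ) 1 ∧
      (lam • z i₁ + (1 - lam) • z i₂).1 ≥ ((n : ℝ)⁻¹ • ∑ i, z i).1 ∧
      (lam • z i₁ + (1 - lam) • z i₂).2 ≤ ((n : ℝ)⁻¹ • ∑ i, z i).2 := by
  have : Nonempty (Fin n) := ⟨⟨0, hn⟩⟩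
  have hn' : (n : ℝ) ≠ 0 := by positivity
  obtain ⟨i, j, t, ht, h₁, h₂⟩ := exists_pair_convexCombination_nonneg
    (fun i => (z i).1 - (n : ℝ)⁻¹ * ∑ k, (z k).1) (fun i => (n : ℝ)⁻¹ * ∑ k, (z k).2 - (z i).2)
    (by simp [Finset.sum_sub_distrib, hn']) (by simp [Finset.sum_sub_distrib, hn'])
  refine ⟨i, j, t, ht, ?_, ?_⟩
  · simp only [Prod.fst_add, Prod.smul_fst, Prod.fst_sum, smul_eq_mul]
    linarith
  · simp only [Prod.snd_add, Prod.smul_snd, Prod.snd_sum, smul_eq_mul]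
    linarith
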